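/- Let β > 0 with β² ≠ 1/4, set γ = √(1/4 − β²) (principal square root), let m ≥ 1 be an integer, and set W(ζ) = W_{0,γ}(2mζ) for ζ ∈ ℂ ∖ (−∞,0]. Then for every η > 0, lim_{ε→0⁺} ( W(−η + iε) − W(−η − iε) ) = 2i cos(γπ) W(η). -/

import Mathlib

open MeasureTheory Complex Set
open scoped ENNReal Real

noncomputable section

/-- Pochhammer symbol `(a)_s = a (a+1) ⋯ (a+s−1)`. -/
def poch (a : ℂ) (s : ℕ) : ℂ := ∏ i ∈ Finset.range s, (a + (i : ℂ))

/-- Confluent hypergeometric function `M(a,b,ζ) = ∑_s (a)_s/((b)_s s!) ζ^s`. -/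
def chgM (a b ζ : ℂ) : ℂ := ∑' s : ℕ, poch a s / (poch b s * (Nat.factorial s : ℂ)) * ζ ^ s

/-- Whittaker function `M_{0,γ}(ζ) = e^{−ζ/2} ζ^{1/2+γ} M(1/2+γ, 1+2γ, ζ)`
(principal branch of the complex power). -/
def whittM (γ ζ : ℂ) : ℂ :=
  Complex.exp (-ζ / 2) * ζ ^ ((1 : ℂ) / 2 + γ) * chgM ((1 : ℂ) / 2 + γ) (1 + 2 * γ) ζ

/-- Whittaker function
`W_{0,γ}(ζ) = (Γ(−2γ)/Γ(1/2−γ)) M_{0,γ}(ζ) + (Γ(2γ)/Γ(1/2+γ)) M_{0,−γ}(ζ)`. -/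
def whittW (γ ζ : ℂ) : ℂ :=
  Complex.Gamma (-(2 * γ)) / Complex.Gamma ((1 : ℂ) / 2 - γ) * whittM γ ζ
    + Complex.Gamma (2 * γ) / Complex.Gamma ((1 : ℂ) / 2 + γ) * whittM (-γ) ζ

/-- `γ = √(1/4 − β²)`, principal square root. -/
def gam (β : ℝ) : ℂ := ((1 / 4 - β ^ 2 : ℝ) : ℂ) ^ ((1 : ℂ) / 2)

/-- The value of the Pochhammer symbol is nonzero when no factor vanishes. -/
theorem poch_ne_zero {b : ℂ} (hb : ∀ n : ℕ, b + n ≠ 0) (s : ℕ) : poch b s ≠ 0 :=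
  Finset.prod_ne_zero_iff.2 fun i _ => hb i

theorem poch_succ (a : ℂ) (s : ℕ) : poch a (s + 1) = poch a s * (a + s) :=
  Finset.prod_range_succ _ _

theorem poch_succ' (a : ℂ) (s : ℕ) : poch a (s + 1) = a * poch (a + 1) s := by
  simp only [poch, Finset.prod_range_succ', Nat.cast_add, Nat.cast_one, Nat.cast_zero, add_zero]
  rw [mul_comm]
  congr 1
  exact Finset.prod_congr rfl fun i _ => by ring

/-- The Chu–Vandermonde identity in its alternating form. -/
theorem sum_choose_mul_poch_div (n : ℕ) : ∀ a b : ℂ, (∀ n : ℕ, b + n ≠ 0) →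
    ∑ k ∈ Finset.range (n + 1), (n.choose k : ℂ) * ((-1) ^ k * (poch a k / poch b k)) =
      poch (b - a) n / poch b n := by
  induction n with
  | zero => intro a b _; simp [poch]
  | succ n ih =>
    intro a b hb
    have hb1 : ∀ n : ℕ, b + 1 + n ≠ 0 := fun n => by
      have := hb (n + 1)
      push_cast at this
      rwa [add_assoc, add_comm (1 : ℂ)]
    have hb0 : b ≠ 0 := by simpa using hb 0
    have hshift : ∀ k : ℕ, poch a (k + 1) / poch b (k + 1) =
        a / b * (poch (a + 1) k / poch (b + 1) k) := fun k => by
      rw [poch_succ', poch_succ', mul_div_mul_comm]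
    have hsplit : ∑ k ∈ Finset.range (n + 2),
          ((n + 1).choose k : ℂ) * ((-1) ^ k * (poch a k / poch b k)) =
        (∑ k ∈ Finset.range (n + 1), (n.choose k : ℂ) * ((-1) ^ k * (poch a k / poch b k))) -
          a / b * ∑ k ∈ Finset.range (n + 1),
            (n.choose k : ℂ) * ((-1) ^ k * (poch (a + 1) k / poch (b + 1) k)) := by
      have hn : ∑ k ∈ Finset.range (n + 1),
            (n.choose k : ℂ) * ((-1) ^ k * (poch a k / poch b k)) =
          ∑ k ∈ Finset.range (n + 2),
            (n.choose k : ℂ) * ((-1) ^ k * (poch a k / poch b k)) := by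
        rw [Finset.sum_range_succ _ (n + 1)]
        simp
      rw [hn, Finset.sum_range_succ', Finset.sum_range_succ' _ (n + 1), Finset.mul_sum,
        add_sub_right_comm, ← Finset.sum_sub_distrib]
      congr 1
      · refine Finset.sum_congr rfl fun k _ => ?_
        rw [hshift, Nat.choose_succ_succ]
        push_cast
        ring
      · simp
    rw [hsplit, ih a b hb, ih (a + 1) (b + 1) hb1, add_sub_add_right_eq_sub,
      poch_succ (b - a)]
    have h1 := poch_ne_zero hb1 n
    have h2 := poch_ne_zero hb n
    have h3 := hb n
    have h4 : poch b n * (b + n) = b * poch (b + 1) n := by rw [← poch_succ, poch_succ']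
    rw [poch_succ b n]
    have h5 : a / b * (poch (b - a) n / poch (b + 1) n) =
        a * poch (b - a) n / (poch b n * (b + n)) := by
      rw [h4]; field_simp
    rw [h5]
    field_simp
    ring

/-- The coefficients of the confluent hypergeometric series. -/
def chgCoeff (a b : ℂ) (s : ℕ) : ℂ := poch a s / (poch b s * (Nat.factorial s : ℂ))

theorem summable_norm_chgCoeff_mul_pow {a b : ℂ} (hb : ∀ n : ℕ, b + n ≠ 0) (z : ℂ) :
    Summable fun s => ‖chgCoeff a b s * z ^ s‖ := by
  have hratio : Filter.Tendsto (fun s : ℕ => ‖(a + s) / (b + s) * (z / (s + 1))‖)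
      Filter.atTop (nhds 0) := by
    have h1 : Filter.Tendsto (fun s : ℕ => (a + s) / (b + s)) Filter.atTop (nhds 1) := by
      have := tendsto_add_mul_div_add_mul_atTop_nhds a b (1 : ℂ) (one_ne_zero (α := ℂ))
      simpa using this
    have h2 : Filter.Tendsto (fun s : ℕ => z / ((s : ℂ) + 1)) Filter.atTop (nhds 0) := by
      have := (tendsto_one_div_add_atTop_nhds_zero_nat (𝕜 := ℂ)).const_mul z
      simpa [div_eq_mul_inv] using this
    simpa using (h1.mul h2).norm
  refine summable_of_ratio_norm_eventually_le (r := 1 / 2) (by norm_num) ?_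
  filter_upwards [hratio.eventually_le_const (show (0 : ℝ) < 1 / 2 by norm_num)] with s hs
  have hstep : chgCoeff a b (s + 1) * z ^ (s + 1) =
      (a + s) / (b + s) * (z / (s + 1)) * (chgCoeff a b s * z ^ s) := by
    have h1 := poch_ne_zero hb s
    have h2 := hb s
    have h3 : (s : ℂ) + 1 ≠ 0 := Nat.cast_add_one_ne_zero s
    have h4 : (Nat.factorial s : ℂ) ≠ 0 := by exact_mod_cast s.factorial_ne_zero
    simp only [chgCoeff, poch_succ, Nat.factorial_succ, Nat.cast_mul, Nat.cast_add, Nat.cast_one,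
      pow_succ]
    field_simp
  rw [norm_norm, norm_norm, hstep, norm_mul]
  gcongr

theorem continuous_chgM {a b : ℂ} (hb : ∀ n : ℕ, b + n ≠ 0) : Continuous (chgM a b) := by
  rw [continuous_iff_continuousAt]
  intro z
  have hon : ContinuousOn (chgM a b) (Metric.ball 0 (‖z‖ + 1)) := by
    refine continuousOn_tsum (fun s => by fun_prop)
      (summable_norm_chgCoeff_mul_pow (a := a) hb ((‖z‖ + 1 : ℝ) : ℂ)) fun s w hw => ?_
    rw [mem_ball_zero_iff] at hw
    rw [norm_mul, norm_mul, norm_pow, norm_pow, Complex.norm_real,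
      Real.norm_of_nonneg (by positivity)]
    exact mul_le_mul_of_nonneg_left (pow_le_pow_left₀ (norm_nonneg _) hw.le _) (norm_nonneg _)
  exact hon.continuousAt (Metric.isOpen_ball.mem_nhds (by simp))

/-- Kummer's transformation. -/
theorem chgM_neg {a b : ℂ} (hb : ∀ n : ℕ, b + n ≠ 0) (z : ℂ) :
    chgM a b (-z) = Complex.exp (-z) * chgM (b - a) b z := by
  have key : Complex.exp z * chgM a b (-z) = chgM (b - a) b z := by
    have hexp : Complex.exp z = ∑' n : ℕ, z ^ n / (n.factorial : ℂ) := by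
      rw [Complex.exp_eq_exp_ℂ, NormedSpace.exp_eq_tsum_div]
    rw [mul_comm, hexp, chgM, chgM]
    refine (tsum_mul_tsum_eq_tsum_sum_antidiagonal_of_summable_norm
      (summable_norm_chgCoeff_mul_pow (a := a) hb (-z))
      (NormedSpace.norm_expSeries_div_summable z)).trans (tsum_congr fun n => ?_)
    rw [Finset.Nat.sum_antidiagonal_eq_sum_range_succ_mk, ← div_div,
      ← sum_choose_mul_poch_div n a b hb, Finset.sum_div, Finset.sum_mul]
    refine Finset.sum_congr rfl fun k hk => ?_
    have hkn : k ≤ n := Nat.lt_succ_iff.1 (Finset.mem_range.1 hk)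
    have h1 := poch_ne_zero hb k
    have hfac : ∀ j : ℕ, (Nat.factorial j : ℂ) ≠ 0 := fun j => by
      exact_mod_cast j.factorial_ne_zero
    have hz : z ^ n = z ^ k * z ^ (n - k) := by rw [← pow_add, Nat.add_sub_cancel' hkn]
    have h2 := hfac k
    have h3 := hfac (n - k)
    have h4 := hfac n
    simp only [chgCoeff]
    rw [Nat.cast_choose ℂ hkn, hz, neg_pow z k]
    field_simp
  rw [← key, ← mul_assoc, ← Complex.exp_add, neg_add_cancel, Complex.exp_zero, one_mul]

/-- A one-sided boundary value of `M_{0,γ}` at a negative real point follows from that of the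
logarithm. -/
theorem tendsto_whittM_of_tendsto_log {γ : ℂ} (hγ : ∀ n : ℕ, 1 + 2 * γ + n ≠ 0) {x : ℝ}
    (hx : 0 < x) {l : Filter ℂ} (hl : l ≤ nhds (-(x : ℂ))) {θ : ℂ}
    (hlog : Filter.Tendsto Complex.log l (nhds (Real.log x + θ))) :
    Filter.Tendsto (whittM γ) l (nhds (Complex.exp (θ * (1 / 2 + γ)) * whittM γ x)) := by
  have hx0 : (x : ℂ) ≠ 0 := by exact_mod_cast hx.ne'
  have hpow : Filter.Tendsto (fun z : ℂ => z ^ ((1 : ℂ) / 2 + γ)) l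
      (nhds (Complex.exp ((Real.log x + θ) * (1 / 2 + γ)))) := by
    refine ((Complex.continuous_exp.tendsto _).comp (hlog.mul_const _)).congr' ?_
    filter_upwards [hl (isOpen_ne.mem_nhds (neg_ne_zero.2 hx0))] with z hz
    exact (Complex.cpow_def_of_ne_zero hz _).symm
  have hexp : Filter.Tendsto (fun z : ℂ => Complex.exp (-z / 2)) l
      (nhds (Complex.exp (-(-(x : ℂ)) / 2))) :=
    Filter.Tendsto.mono_left (Continuous.tendsto (by fun_prop) _) hl
  have hM := ((continuous_chgM (a := 1 / 2 + γ) hγ).tendsto (-(x : ℂ))).mono_left hl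
  have hvalue : Complex.exp (-(-(x : ℂ)) / 2) *
        Complex.exp ((Real.log x + θ) * (1 / 2 + γ)) * chgM (1 / 2 + γ) (1 + 2 * γ) (-x) =
      Complex.exp (θ * (1 / 2 + γ)) * whittM γ x := by
    have hb : 1 + 2 * γ - (1 / 2 + γ) = 1 / 2 + γ := by ring
    have hhalf : Complex.exp (-(-(x : ℂ)) / 2) * Complex.exp (-x) = Complex.exp (-x / 2) := by
      rw [← Complex.exp_add]
      ring_nf
    rw [chgM_neg hγ, hb, whittM, Complex.cpow_def_of_ne_zero hx0, ← Complex.ofReal_log hx.le,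
      ← hhalf, add_mul, Complex.exp_add]
    ring
  rw [← hvalue]
  exact (hexp.mul hpow).mul hM

/-- The jump of `M_{0,γ}` across the negative real axis. -/
theorem tendsto_whittM_sub {γ : ℂ} (hγ : ∀ n : ℕ, 1 + 2 * γ + n ≠ 0) {x : ℝ} (hx : 0 < x) :
    Filter.Tendsto
      (fun δ : ℝ => whittM γ (-(x : ℂ) + δ * Complex.I) - whittM γ (-(x : ℂ) - δ * Complex.I))
      (nhdsWithin 0 (Set.Ioi 0))
      (nhds (2 * Complex.I * Complex.cos (γ * (π : ℂ)) * whittM γ x)) := by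
  have hre : (-(x : ℂ)).re < 0 := by simpa using hx
  have him : (-(x : ℂ)).im = 0 := by simp
  have hnorm : ‖-(x : ℂ)‖ = x := by
    rw [norm_neg, Complex.norm_real, Real.norm_of_nonneg hx.le]
  have hup := Complex.tendsto_log_nhdsWithin_im_nonneg_of_re_neg_of_im_zero hre him
  have hdown := Complex.tendsto_log_nhdsWithin_im_neg_of_re_neg_of_im_zero hre him
  rw [hnorm] at hup hdown
  rw [sub_eq_add_neg] at hdown
  have hpathUp : Filter.Tendsto (fun δ : ℝ => -(x : ℂ) + δ * Complex.I)
      (nhdsWithin 0 (Set.Ioi 0)) (nhdsWithin (-(x : ℂ)) {z | 0 ≤ z.im}) := by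
    refine tendsto_nhdsWithin_iff.2 ⟨Filter.Tendsto.mono_left ?_ nhdsWithin_le_nhds, ?_⟩
    · exact Continuous.tendsto' (by fun_prop) _ _ (by simp)
    · filter_upwards [self_mem_nhdsWithin] with δ hδ
      simpa using le_of_lt hδ
  have hpathDown : Filter.Tendsto (fun δ : ℝ => -(x : ℂ) - δ * Complex.I)
      (nhdsWithin 0 (Set.Ioi 0)) (nhdsWithin (-(x : ℂ)) {z | z.im < 0}) := by
    refine tendsto_nhdsWithin_iff.2 ⟨Filter.Tendsto.mono_left ?_ nhdsWithin_le_nhds, ?_⟩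
    · exact Continuous.tendsto' (by fun_prop) _ _ (by simp)
    · filter_upwards [self_mem_nhdsWithin] with δ hδ
      simpa using hδ
  have hjump := ((tendsto_whittM_of_tendsto_log hγ hx nhdsWithin_le_nhds hup).comp hpathUp).sub
    ((tendsto_whittM_of_tendsto_log hγ hx nhdsWithin_le_nhds hdown).comp hpathDown)
  have hcoeff : Complex.exp (π * Complex.I * (1 / 2 + γ)) -
      Complex.exp (-(π * Complex.I) * (1 / 2 + γ)) =
        2 * Complex.I * Complex.cos (γ * π) := by
    have h1 : (π : ℂ) * Complex.I * (1 / 2 + γ) = π / 2 * Complex.I + γ * π * Complex.I := by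
      ring
    have h2 : -((π : ℂ) * Complex.I) * (1 / 2 + γ) =
        -(π / 2 * Complex.I) + -(γ * π) * Complex.I := by
      ring
    rw [h1, h2, Complex.exp_add, Complex.exp_add, Complex.exp_neg, Complex.exp_pi_div_two_mul_I,
      Complex.inv_I, Complex.cos]
    ring
  rw [← hcoeff, sub_mul]
  exact hjump

/-- The jump of `W_{0,γ}` across the negative real axis. -/
theorem tendsto_whittW_sub {γ : ℂ} (hpos : ∀ n : ℕ, 1 + 2 * γ + n ≠ 0)
    (hneg : ∀ n : ℕ, 1 + 2 * -γ + n ≠ 0) {x : ℝ} (hx : 0 < x) :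
    Filter.Tendsto
      (fun δ : ℝ => whittW γ (-(x : ℂ) + δ * Complex.I) - whittW γ (-(x : ℂ) - δ * Complex.I))
      (nhdsWithin 0 (Set.Ioi 0))
      (nhds (2 * Complex.I * Complex.cos (γ * (π : ℂ)) * whittW γ x)) := by
  have h := ((tendsto_whittM_sub hpos hx).const_mul
      (Complex.Gamma (-(2 * γ)) / Complex.Gamma ((1 : ℂ) / 2 - γ))).add
    ((tendsto_whittM_sub hneg hx).const_mul
      (Complex.Gamma (2 * γ) / Complex.Gamma ((1 : ℂ) / 2 + γ)))
  rw [neg_mul, Complex.cos_neg] at h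
  unfold whittW
  convert! h using 2 <;> ring

theorem gam_sq (β : ℝ) : gam β ^ 2 = ((1 / 4 - β ^ 2 : ℝ) : ℂ) := by
  have h := Complex.cpow_nat_inv_pow ((1 / 4 - β ^ 2 : ℝ) : ℂ) two_ne_zero
  rwa [Nat.cast_ofNat, ← one_div (2 : ℂ)] at h

/-- A square root of a real number below `1 / 4` never makes `1 + 2 γ` a nonpositive integer. -/
theorem one_add_two_mul_add_natCast_ne_zero {β : ℝ} (hβ : 0 < β) {γ : ℂ}
    (hγ : γ ^ 2 = ((1 / 4 - β ^ 2 : ℝ) : ℂ)) (n : ℕ) : 1 + 2 * γ + n ≠ 0 := by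
  intro h
  have hc : ((4 * (1 / 4 - β ^ 2) : ℝ) : ℂ) = (((n + 1) ^ 2 : ℝ) : ℂ) := by
    rw [Complex.ofReal_mul, ← hγ]
    push_cast
    linear_combination (2 * γ - 1 - n) * h
  have hr : 4 * (1 / 4 - β ^ 2) = ((n : ℝ) + 1) ^ 2 := by exact_mod_cast hc
  have hn : (0 : ℝ) ≤ n := n.cast_nonneg
  nlinarith [pow_pos hβ 2]

/-- Lemma 3.1, analytic continuation: for `W(ζ) = W_{0,γ}(2mζ)` with
`γ = √(1/4 − β²)`, the jump of `W` across the branch cut on the negative real axis is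
`lim_{ε→0⁺} (W(−η+iε) − W(−η−iε)) = 2i cos(γπ) W(η)` for every `η > 0`. -/
theorem whittW_jump_across_cut (β : ℝ) (hβ : 0 < β) (hβ4 : β ^ 2 ≠ 1 / 4)
    (m : ℕ) (hm : 1 ≤ m) (η : ℝ) (hη : 0 < η) :
    Filter.Tendsto
      (fun ε : ℝ =>
        whittW (gam β) (2 * (m : ℂ) * (-(η : ℂ) + (ε : ℂ) * Complex.I))
          - whittW (gam β) (2 * (m : ℂ) * (-(η : ℂ) - (ε : ℂ) * Complex.I)))
      (nhdsWithin 0 (Set.Ioi 0))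
      (nhds (2 * Complex.I * Complex.cos (gam β * (π : ℂ)) *
        whittW (gam β) (2 * (m : ℂ) * (η : ℂ)))) := by
  have hm0 : (0 : ℝ) < 2 * m := by
    have : (0 : ℝ) < m := by exact_mod_cast hm
    positivity
  have hscale : Filter.Tendsto (fun ε : ℝ => 2 * (m : ℝ) * ε)
      (nhdsWithin 0 (Set.Ioi 0)) (nhdsWithin 0 (Set.Ioi 0)) := by
    refine tendsto_nhdsWithin_iff.2 ⟨Filter.Tendsto.mono_left ?_ nhdsWithin_le_nhds, ?_⟩
    · exact Continuous.tendsto' (by fun_prop) _ _ (by simp)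
    · filter_upwards [self_mem_nhdsWithin] with ε hε
      exact mul_pos hm0 hε
  have h := (tendsto_whittW_sub (one_add_two_mul_add_natCast_ne_zero hβ (gam_sq β))
    (one_add_two_mul_add_natCast_ne_zero hβ ((neg_sq _).trans (gam_sq β)))
    (mul_pos hm0 hη)).comp hscale
  convert! h using 2
  · simp only [Function.comp_apply]
    push_cast
    ring_nf
  · push_cast
    rfl
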